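/- arXiv:1806.05589 — 2 statements merged into one kernel-verified Lean document; each statement's English description precedes it below -/
import Mathlib

section
/- Let Y and U be jointly distributed random variables taking values in finite sets 𝒴 and 𝒰, let μ ∈ (0,1/2), ε > 0 and c > 0. If Pr(|h(Y|U) − c| > ε) < μ, then |H(Y|U) − c| < ε + μ·log₂(|𝒴|/μ²). -/
open scoped Classical BigOperators

noncomputable section

namespace Paper

variable {Ω : Type*}

/-- Probability of an event under a discrete probability distribution. -/
def pr (μ : PMF Ω) (E : Set Ω) : ℝ := (μ.toOuterMeasure E).toReal

/-- Conditional probability `Pr(E | F)`. -/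
def cpr (μ : PMF Ω) (E F : Set Ω) : ℝ := pr μ (E ∩ F) / pr μ F

/-- Entropy spectrum frequency `h_X(x) = -log₂ Pr(X = x)`. -/
def hs {α : Type*} (μ : PMF Ω) (X : Ω → α) (x : α) : ℝ :=
  - Real.logb 2 (pr μ {ω | X ω = x})

/-- Conditional entropy spectrum frequency `h_{X|Y}(x|y) = -log₂ Pr(X = x | Y = y)`. -/
def hcs {α β : Type*} (μ : PMF Ω) (X : Ω → α) (Y : Ω → β) (x : α) (y : β) : ℝ :=
  - Real.logb 2 (cpr μ {ω | X ω = x} {ω | Y ω = y})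

/-- Conditional Shannon entropy (bits) `H(X|Y)`. -/
def Hc {α β : Type*} [Fintype α] [Fintype β] (μ : PMF Ω) (X : Ω → α) (Y : Ω → β) : ℝ :=
  - ∑ x : α, ∑ y : β, pr μ ({ω | X ω = x} ∩ {ω | Y ω = y}) *
      Real.logb 2 (cpr μ {ω | X ω = x} {ω | Y ω = y})

/-- Shannon entropy (bits) of `X` conditioned on the event `E`. -/
def HEvt {α : Type*} [Fintype α] (μ : PMF Ω) (X : Ω → α) (E : Set Ω) : ℝ :=
  - ∑ x : α, cpr μ {ω | X ω = x} E * Real.logb 2 (cpr μ {ω | X ω = x} E)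

/-- Conditional Shannon entropy (bits) `H(X|Y)` computed given the event `E`. -/
def HcEvt {α β : Type*} [Fintype α] [Fintype β] (μ : PMF Ω) (X : Ω → α) (Y : Ω → β)
    (E : Set Ω) : ℝ :=
  - ∑ x : α, ∑ y : β, cpr μ ({ω | X ω = x} ∩ {ω | Y ω = y}) E *
      Real.logb 2 (cpr μ {ω | X ω = x} ({ω | Y ω = y} ∩ E))

/-- `A ⊸ B ⊸ C` : `A` and `C` are conditionally independent given `B`. -/
def Markov {α β γ : Type*} (μ : PMF Ω) (A : Ω → α) (B : Ω → β) (C : Ω → γ) : Prop :=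
  ∀ a b c, pr μ {ω | A ω = a ∧ B ω = b ∧ C ω = c} * pr μ {ω | B ω = b} =
    pr μ {ω | A ω = a ∧ B ω = b} * pr μ {ω | B ω = b ∧ C ω = c}

/-- A discrete memoryless channel from `𝒳` to `𝒴`. -/
structure Channel (𝒳 𝒴 : Type*) [Fintype 𝒴] where
  w : 𝒳 → 𝒴 → ℝ
  nonneg : ∀ x y, 0 ≤ w x y
  sum_one : ∀ x, ∑ y, w x y = 1

/-- The `n`-fold product channel `W^n(𝐲|𝐱)`. -/
def Channel.pn {𝒳 𝒴 : Type*} [Fintype 𝒴] (W : Channel 𝒳 𝒴) (n : ℕ)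
    (x : Fin n → 𝒳) (y : Fin n → 𝒴) : ℝ := ∏ i, W.w (x i) (y i)

/-- `Y` is an output of `X` through `W^n`. -/
def IsOutput {𝒳 𝒴 : Type*} [Fintype 𝒴] {n : ℕ} (μ : PMF Ω)
    (X : Ω → Fin n → 𝒳) (Y : Ω → Fin n → 𝒴) (W : Channel 𝒳 𝒴) : Prop :=
  ∀ x y, 0 < pr μ {ω | X ω = x} → cpr μ {ω | Y ω = y} {ω | X ω = x} = W.pn n x y

/-- `W^n(B|𝐱)`. -/
def imgMass {𝒳 𝒴 : Type*} [Fintype 𝒴] (W : Channel 𝒳 𝒴) (n : ℕ)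
    (x : Fin n → 𝒳) (B : Finset (Fin n → 𝒴)) : ℝ := ∑ y ∈ B, W.pn n x y

/-- `B` is an `η`-image of `A` by `W`. -/
def IsImage {𝒳 𝒴 : Type*} [Fintype 𝒴] (W : Channel 𝒳 𝒴) (n : ℕ)
    (A : Set (Fin n → 𝒳)) (η : ℝ) (B : Finset (Fin n → 𝒴)) : Prop :=
  ∀ x ∈ A, η ≤ imgMass W n x B

/-- Minimum cardinality of an `η`-image of `A` by `W`. -/
def gimg {𝒳 𝒴 : Type*} [Fintype 𝒴] (W : Channel 𝒳 𝒴) (n : ℕ)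
    (A : Set (Fin n → 𝒳)) (η : ℝ) : ℕ :=
  sInf {k | ∃ B : Finset (Fin n → 𝒴), IsImage W n A η B ∧ B.card = k}

/-- `B` is an `η`-quasi-image of the pmf `P` by `W`. -/
def IsQImage {𝒳 𝒴 : Type*} [Fintype 𝒳] [Fintype 𝒴] (W : Channel 𝒳 𝒴) (n : ℕ)
    (P : (Fin n → 𝒳) → ℝ) (η : ℝ) (B : Finset (Fin n → 𝒴)) : Prop :=
  η ≤ ∑ x, imgMass W n x B * P x

/-- Minimum cardinality of an `η`-quasi-image of `P` by `W`. -/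
def gqimg {𝒳 𝒴 : Type*} [Fintype 𝒳] [Fintype 𝒴] (W : Channel 𝒳 𝒴) (n : ℕ)
    (P : (Fin n → 𝒳) → ℝ) (η : ℝ) : ℕ :=
  sInf {k | ∃ B : Finset (Fin n → 𝒴), IsQImage W n P η B ∧ B.card = k}

/-- The number of values in the support of `U`. -/
def suppCard {α : Type*} [Fintype α] (μ : PMF Ω) (U : Ω → α) : ℕ :=
  (Finset.univ.filter (fun u => 0 < pr μ {ω | U ω = u})).card

/-- Mutual information (bits). -/
def MI {α β : Type*} [Fintype α] [Fintype β] (μ : PMF Ω) (A : Ω → α) (B : Ω → β) : ℝ :=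
  ∑ a : α, ∑ b : β, pr μ {ω | A ω = a ∧ B ω = b} *
    Real.logb 2 (pr μ {ω | A ω = a ∧ B ω = b} / (pr μ {ω | A ω = a} * pr μ {ω | B ω = b}))

/-- Conditional mutual information (bits). -/
def CMI {α β γ : Type*} [Fintype α] [Fintype β] [Fintype γ] (μ : PMF Ω)
    (A : Ω → α) (B : Ω → β) (C : Ω → γ) : ℝ :=
  ∑ c : γ, pr μ {ω | C ω = c} * ∑ a : α, ∑ b : β,
    cpr μ {ω | A ω = a ∧ B ω = b} {ω | C ω = c} *
      Real.logb 2 (cpr μ {ω | A ω = a ∧ B ω = b} {ω | C ω = c} /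
        (cpr μ {ω | A ω = a} {ω | C ω = c} * cpr μ {ω | B ω = b} {ω | C ω = c}))

/-- `D_{wh}(w‖w'|p̂)` in the extended reals, with the stated conventions. -/
def Dkl {𝒳 𝒴 : Type*} [Fintype 𝒳] [Fintype 𝒴] (w w' wh : Channel 𝒳 𝒴)
    (p : 𝒳 → ℝ) : EReal :=
  if ∃ x y, 0 < wh.w x y * p x ∧ w'.w x y = 0 ∧ 0 < w.w x y then ⊤
  else if ∃ x y, 0 < wh.w x y * p x ∧ w.w x y = 0 ∧ 0 < w'.w x y then ⊥
  else ((∑ x : 𝒳, ∑ y : 𝒴, wh.w x y * p x * Real.logb 2 (w.w x y / w'.w x y) : ℝ) : EReal)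

/-- `sup { D_{wh}(w‖w'|p̂) }` over channels `wh` and pmfs `p̂` on `𝒳`. -/
def DklSup {𝒳 𝒴 : Type*} [Fintype 𝒳] [Fintype 𝒴] (w w' : Channel 𝒳 𝒴) : EReal :=
  sSup {d : EReal | ∃ (wh : Channel 𝒳 𝒴) (p : 𝒳 → ℝ),
    (∀ x, 0 ≤ p x) ∧ (∑ x, p x = 1) ∧ d = Dkl w w' wh p}


/-- Probabilities of events determined by a finitely valued `f` are finite sums of point
probabilities. -/
theorem pr_preimage_eq_sum {Ω ι : Type*} [Fintype ι] (μ : PMF Ω) (f : Ω → ι) (S : Set ι) :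
    pr μ (f ⁻¹' S) = ∑ i with i ∈ S, pr μ (f ⁻¹' {i}) := by
  have key : ∀ T : Finset ι, pr μ (f ⁻¹' (T : Set ι)) = ∑ i ∈ T, (μ.map f i).toReal := by
    intro T
    unfold pr
    rw [← PMF.toOuterMeasure_map_apply, PMF.toOuterMeasure_apply_finset,
      ENNReal.toReal_sum fun i _ => PMF.apply_ne_top _ i]
  have h1 : ∀ i, pr μ (f ⁻¹' {i}) = (μ.map f i).toReal := fun i => by
    simpa using key {i}
  simp_rw [h1]
  rw [← key]
  simp

theorem pr_univ {Ω : Type*} (μ : PMF Ω) : pr μ Set.univ = 1 := by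
  have h : μ.toOuterMeasure Set.univ = 1 :=
    (PMF.toOuterMeasure_apply_eq_one_iff μ Set.univ).2 (Set.subset_univ _)
  simp [pr, h]

theorem pr_nonneg {Ω : Type*} (μ : PMF Ω) (E : Set Ω) : 0 ≤ pr μ E :=
  ENNReal.toReal_nonneg

/-- A tangent-line form of the log-sum inequality. -/
theorem sum_mul_neg_log_div_le {ι : Type*} (s : Finset ι) (p q : ι → ℝ)
    (hp : ∀ i, 0 ≤ p i) (hpq : ∀ i, p i ≤ q i) {t : ℝ} (ht : 0 < t) :
    ∑ i ∈ s, p i * (-Real.log (p i / q i)) ≤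
      (∑ i ∈ s, p i) * Real.log t + (∑ i ∈ s, q i) / t - ∑ i ∈ s, p i := by
  rw [Finset.sum_mul, Finset.sum_div, ← Finset.sum_add_distrib, ← Finset.sum_sub_distrib]
  refine Finset.sum_le_sum fun i _ => ?_
  rcases (hp i).eq_or_lt with h0 | h0
  · have : 0 ≤ q i / t := div_nonneg ((hp i).trans (hpq i)) ht.le
    simpa [← h0] using this
  · have hq : 0 < q i := h0.trans_le (hpq i)
    have h1 := Real.log_le_sub_one_of_pos (div_pos hq (mul_pos h0 ht))
    rw [Real.log_div hq.ne' (mul_pos h0 ht).ne', Real.log_mul h0.ne' ht.ne'] at h1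
    rw [Real.log_div h0.ne' hq.ne']
    have h2 := mul_le_mul_of_nonneg_left h1 h0.le
    have h3 : p i * (q i / (p i * t) - 1) = q i / t - p i := by
      field_simp
    linarith

/-- If the weighted values `-log (p i / q i)` concentrate around `c`, then so does their mean. -/
theorem abs_sum_mul_neg_log_div_sub_lt {ι : Type*} [Fintype ι] (p q : ι → ℝ)
    (hp : ∀ i, 0 ≤ p i) (hpq : ∀ i, p i ≤ q i) (hp1 : ∑ i, p i = 1)
    {N : ℝ} (hN : 1 ≤ N) (hq : ∑ i, q i ≤ N) {m ε c : ℝ} (hm0 : 0 < m) (hm1 : m < 1 / 2)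
    (h : ∑ i with ε < |-Real.log (p i / q i) - c|, p i < m) :
    |∑ i, p i * (-Real.log (p i / q i)) - c| < ε + m * Real.log (N / m ^ 2) := by
  set l : ι → ℝ := fun i => -Real.log (p i / q i) with hl
  set B : Finset ι := Finset.univ.filter fun i => ε < |l i - c| with hB
  set G : Finset ι := Finset.univ.filter fun i => ¬ ε < |l i - c| with hG
  set δ : ℝ := ∑ i ∈ B, p i with hδ
  have hq0 : ∀ i, 0 ≤ q i := fun i => (hp i).trans (hpq i)
  have hN0 : 0 < N := by linarith
  have hδ0 : 0 ≤ δ := Finset.sum_nonneg fun i _ => hp i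
  have hδm : δ < m := h
  have hGp : ∑ i ∈ G, p i = 1 - δ := by
    rw [← hp1, hδ, hB, hG, ← Finset.sum_filter_add_sum_filter_not Finset.univ
      (fun i => ε < |l i - c|) p]
    ring
  have hsplit : ∑ i, p i * l i = ∑ i ∈ B, p i * l i + ∑ i ∈ G, p i * l i :=
    (Finset.sum_filter_add_sum_filter_not Finset.univ _ _).symm
  have hqs : ∀ s : Finset ι, ∑ i ∈ s, q i ≤ N := fun s =>
    (Finset.sum_le_sum_of_subset_of_nonneg (Finset.subset_univ s) fun i _ _ => hq0 i).trans hq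
  have hGabs : ∀ i ∈ G, |l i - c| ≤ ε := fun i hi => not_lt.1 (Finset.mem_filter.1 hi).2
  have hGup : ∑ i ∈ G, p i * l i ≤ (1 - δ) * (c + ε) := by
    rw [← hGp, Finset.sum_mul]
    refine Finset.sum_le_sum fun i hi => mul_le_mul_of_nonneg_left ?_ (hp i)
    linarith [(abs_le.1 (hGabs i hi)).2]
  have hGlo : (1 - δ) * (c - ε) ≤ ∑ i ∈ G, p i * l i := by
    rw [← hGp, Finset.sum_mul]
    refine Finset.sum_le_sum fun i hi => mul_le_mul_of_nonneg_left ?_ (hp i)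
    linarith [(abs_le.1 (hGabs i hi)).1]
  have hl0 : ∀ i, 0 ≤ l i := fun i =>
    neg_nonneg.2 <| Real.log_nonpos (div_nonneg (hp i) (hq0 i)) (div_le_one_of_le₀ (hpq i) (hq0 i))
  have hBlo : 0 ≤ ∑ i ∈ B, p i * l i :=
    Finset.sum_nonneg fun i _ => mul_nonneg (hp i) (hl0 i)
  have hlogN : 0 ≤ Real.log N := Real.log_nonneg hN
  have hlogm : Real.log m < -(1 / 2) := by
    have h1 := Real.log_lt_log hm0 hm1
    rw [one_div, Real.log_inv] at h1
    linarith [Real.log_two_gt_d9]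
  have hrhs : Real.log (N / m ^ 2) = Real.log N - 2 * Real.log m := by
    rw [Real.log_div hN0.ne' (by positivity), Real.log_pow]
    norm_num
  have hδ1 : 0 < 1 - δ := by linarith
  rw [hrhs, abs_lt]
  constructor
  · have hent := sum_mul_neg_log_div_le G p q hp hpq (div_pos hN0 hδ1)
    rw [hGp, Real.log_div hN0.ne' hδ1.ne'] at hent
    have hdiv : (∑ i ∈ G, q i) / (N / (1 - δ)) ≤ 1 - δ := by
      rw [div_le_iff₀ (div_pos hN0 hδ1)]
      have : (1 - δ) * (N / (1 - δ)) = N := by field_simp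
      linarith [hqs G]
    have hc : c - ε ≤ Real.log N - Real.log (1 - δ) := by
      refine le_of_mul_le_mul_left ?_ hδ1
      linarith
    have hlog : Real.log m < Real.log (1 - δ) := Real.log_lt_log hm0 (by linarith)
    nlinarith [mul_le_mul_of_nonneg_left hc hδ0, mul_le_mul_of_nonneg_left hlog.le hδ0,
      mul_nonneg (sub_nonneg.2 hδm.le) hlogN, mul_pos hm0 (by linarith : 0 < -Real.log m),
      mul_nonneg (sub_nonneg.2 hδm.le) (by linarith : 0 ≤ -Real.log m)]
  · have hent := sum_mul_neg_log_div_le B p q hp hpq (div_pos hN0 hm0)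
    rw [Real.log_div hN0.ne' hm0.ne'] at hent
    have hdiv : (∑ i ∈ B, q i) / (N / m) ≤ m := by
      rw [div_le_iff₀ (div_pos hN0 hm0)]
      have : m * (N / m) = N := by field_simp
      linarith [hqs B]
    have hc : 0 ≤ c + ε := by
      refine nonneg_of_mul_nonneg_right ?_ hδ1
      exact (Finset.sum_nonneg fun i _ => mul_nonneg (hp i) (hl0 i)).trans hGup
    have hlin : δ * (-Real.log m) + m - δ < 2 * m * (-Real.log m) := by
      rcases le_total 1 (-Real.log m) with h1 | h1
      · nlinarith [mul_nonneg (sub_nonneg.2 hδm.le) (sub_nonneg.2 h1)]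
      · nlinarith [mul_nonneg hδ0 (sub_nonneg.2 h1)]
    nlinarith [mul_nonneg (sub_nonneg.2 hδm.le) hlogN, mul_nonneg hδ0 hc]

/-- Lemma `daco entropy`. -/
theorem stability_entropy_bound
    {Ω 𝒴 𝒰 : Type} [Fintype 𝒴] [Fintype 𝒰]
    (μ : PMF Ω) (Y : Ω → 𝒴) (U : Ω → 𝒰)
    (m ε c : ℝ) (hm0 : 0 < m) (hm1 : m < 1 / 2) (hε : 0 < ε) (hc : 0 < c)
    (h : pr μ {ω | |hcs μ Y U (Y ω) (U ω) - c| > ε} < m) :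
    |Hc μ Y U - c| < ε + m * Real.logb 2 ((Fintype.card 𝒴 : ℝ) / m ^ 2) := by
  obtain ⟨ω₀, -⟩ := μ.support_nonempty
  have : Nonempty 𝒴 := ⟨Y ω₀⟩
  set f : Ω → 𝒴 × 𝒰 := fun ω => (Y ω, U ω) with hf
  set p : 𝒴 × 𝒰 → ℝ := fun i => pr μ (f ⁻¹' {i}) with hpdef
  set q : 𝒴 × 𝒰 → ℝ := fun i => pr μ {ω | U ω = i.2} with hqdef
  have hjoint : ∀ y u, {ω | Y ω = y} ∩ {ω | U ω = u} = f ⁻¹' {(y, u)} := by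
    intro y u
    ext ω
    simp [hf]
  have hp : ∀ i, 0 ≤ p i := fun i => pr_nonneg μ _
  have hp1 : ∑ i, p i = 1 := by
    rw [← pr_univ μ, ← Set.preimage_univ (f := f), pr_preimage_eq_sum]
    simp [hpdef]
  have hqsum : ∀ i, q i = ∑ j with j ∈ {j : 𝒴 × 𝒰 | j.2 = i.2}, p j := fun i =>
    pr_preimage_eq_sum μ f {j | j.2 = i.2}
  have hpq : ∀ i, p i ≤ q i := by
    intro i
    rw [hqsum]
    exact Finset.single_le_sum (fun j _ => hp j) (by simp)
  have hU : ∑ u, pr μ {ω | U ω = u} = 1 := by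
    rw [← pr_univ μ, ← Set.preimage_univ (f := U), pr_preimage_eq_sum]
    simp [Set.preimage]
  have hq : ∑ i, q i = Fintype.card 𝒴 := by
    rw [Fintype.sum_prod_type]
    simp [hqdef, hU]
  have hL : 0 < Real.log 2 := Real.log_pos one_lt_two
  have hcpr : ∀ y u, cpr μ {ω | Y ω = y} {ω | U ω = u} = p (y, u) / q (y, u) := by
    intro y u
    rw [cpr, hjoint]
  have hscale : ∀ x : ℝ, -Real.log x - c * Real.log 2 = (-Real.logb 2 x - c) * Real.log 2 := by
    intro x
    rw [Real.logb]
    field_simp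
  have hbad : ∑ i with ε * Real.log 2 < |-Real.log (p i / q i) - c * Real.log 2|, p i < m := by
    have hpre : {ω | |hcs μ Y U (Y ω) (U ω) - c| > ε} =
        f ⁻¹' {i | ε * Real.log 2 < |-Real.log (p i / q i) - c * Real.log 2|} := by
      ext ω
      simp only [Set.mem_ofPred_eq, Set.mem_preimage, hscale, abs_mul, abs_of_pos hL, hcs, hcpr,
        mul_lt_mul_iff_left₀ hL, gt_iff_lt, hf]
    rw [hpre, pr_preimage_eq_sum] at h
    exact h
  have hHc : Hc μ Y U * Real.log 2 = ∑ i, p i * (-Real.log (p i / q i)) := by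
    rw [Hc, ← Finset.sum_neg_distrib, Fintype.sum_prod_type, Finset.sum_mul]
    refine Finset.sum_congr rfl fun y _ => ?_
    rw [← Finset.sum_neg_distrib, Finset.sum_mul]
    refine Finset.sum_congr rfl fun u _ => ?_
    rw [hcpr, hjoint, Real.logb]
    field_simp
    rfl
  have hN : (1 : ℝ) ≤ Fintype.card 𝒴 := by
    exact_mod_cast Fintype.card_pos
  have main := abs_sum_mul_neg_log_div_sub_lt p q hp hpq hp1 hN hq.le hm0 hm1 hbad
  rw [← hHc, ← sub_mul, abs_mul, abs_of_pos hL] at main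
  refine lt_of_mul_lt_mul_right (main.trans_eq ?_) hL.le
  rw [Real.logb]
  field_simp

end Paper
end
end

section
/- Let Y and U be jointly distributed random variables taking values in finite sets 𝒴 and 𝒰, let μ ∈ (0,1/2), ε > 0 and c > 0. If Pr(|h(Y|U) − c| > ε) < μ, then Pr(|h(Y|U) − H(Y|U)| > 2ε + μ·log₂(|𝒴|/μ²)) < μ. -/
open scoped Classical BigOperators

noncomputable section

namespace Paper

variable {Ω : Type*}

/-- The probability of an event determined by a finitely valued random variable is a finite sum. -/
lemma pr_setOf_eq_sum {α : Type*} [Fintype α] (μ : PMF Ω) (f : Ω → α) (P : α → Prop) :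
    pr μ {ω | P (f ω)} = ∑ z with P z, (μ.map f z).toReal := by
  have h1 : {ω | P (f ω)} = f ⁻¹' {z | P z} := rfl
  rw [pr, h1, ← PMF.toOuterMeasure_map_apply, PMF.toOuterMeasure_apply_fintype,
    ENNReal.toReal_sum, Finset.sum_filter]
  · refine Finset.sum_congr rfl fun z _ => ?_
    by_cases hz : P z <;> simp [Set.indicator, hz]
  · intro z _
    by_cases hz : P z
    · rw [Set.indicator_of_mem (s := {z | P z}) hz]
      exact PMF.apply_ne_top _ _
    · rw [Set.indicator_of_notMem (s := {z | P z}) hz]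
      exact ENNReal.zero_ne_top

lemma sum_toReal_eq_one {α : Type*} [Fintype α] (q : PMF α) : ∑ z, (q z).toReal = 1 := by
  rw [← ENNReal.toReal_sum fun z _ => q.apply_ne_top z, ← tsum_fintype (L := .unconditional _), q.tsum_coe,
    ENNReal.toReal_one]

/-- Tangent-line bound for `t * log₂ (s / t)`. -/
lemma mul_neg_logb_div_le {t s a : ℝ} (ht : 0 ≤ t) (hts : t ≤ s) (ha : 0 < a) :
    t * -Real.logb 2 (t / s) ≤ t * Real.logb 2 a + (s / a - t) / Real.log 2 := by
  have hl : 0 < Real.log 2 := Real.log_pos one_lt_two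
  rcases ht.eq_or_lt with rfl | ht
  · simp only [zero_mul, sub_zero, zero_add]
    positivity
  have hs : 0 < s := ht.trans_le hts
  have h1 := Real.log_le_sub_one_of_pos (show 0 < s / (t * a) by positivity)
  rw [Real.log_div hs.ne' (by positivity), Real.log_mul ht.ne' ha.ne'] at h1
  have h2 := mul_le_mul_of_nonneg_left h1 ht.le
  have h3 : t * (s / (t * a) - 1) = s / a - t := by field_simp
  rw [h3] at h2
  rw [Real.logb, Real.logb, Real.log_div ht.ne' hs.ne']
  have h4 : t * -((Real.log t - Real.log s) / Real.log 2)
      = (t * (Real.log s - Real.log t)) / Real.log 2 := by ring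
  have h5 : t * (Real.log a / Real.log 2) + (s / a - t) / Real.log 2
      = (t * Real.log a + (s / a - t)) / Real.log 2 := by ring
  rw [h4, h5]
  gcongr
  linarith

/-- Restricted expectation of the conditional spectrum, bounded for any `a > 0`. -/
lemma sum_mul_neg_logb_le {α β : Type*} [Fintype α] [Fintype β] {p : α × β → ℝ} {r : β → ℝ}
    (hp : ∀ z, 0 ≤ p z) (hr : ∀ u, ∑ y, p (y, u) = r u) (h1 : ∑ z, p z = 1)
    (S : Finset (α × β)) {a : ℝ} (ha : 0 < a) :
    ∑ z ∈ S, p z * -Real.logb 2 (p z / r z.2) ≤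
      (∑ z ∈ S, p z) * Real.logb 2 a +
        ((Fintype.card α : ℝ) / a - ∑ z ∈ S, p z) / Real.log 2 := by
  have hl : 0 < Real.log 2 := Real.log_pos one_lt_two
  have hpr : ∀ z, p z ≤ r z.2 := fun z => by
    rw [← hr]
    exact Finset.single_le_sum (f := fun y => p (y, z.2)) (fun y _ => hp _) (Finset.mem_univ z.1)
  have hr0 : ∀ z : α × β, 0 ≤ r z.2 := fun z => (hp z).trans (hpr z)
  have hsum : ∑ z ∈ S, r z.2 ≤ Fintype.card α := by
    calc ∑ z ∈ S, r z.2 ≤ ∑ z : α × β, r z.2 :=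
          Finset.sum_le_univ_sum_of_nonneg hr0
      _ = ∑ _y : α, ∑ u : β, r u := Fintype.sum_prod_type _
      _ = ∑ _y : α, (1 : ℝ) := by
          refine Finset.sum_congr rfl fun _ _ => ?_
          rw [← h1, Fintype.sum_prod_type_right]
          exact Finset.sum_congr rfl fun u _ => (hr u).symm
      _ = Fintype.card α := by simp
  calc _ ≤ ∑ z ∈ S, (p z * Real.logb 2 a + (r z.2 / a - p z) / Real.log 2) :=
        Finset.sum_le_sum fun z _ => mul_neg_logb_div_le (hp z) (hpr z) ha
    _ = (∑ z ∈ S, p z) * Real.logb 2 a +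
        ((∑ z ∈ S, r z.2) / a - ∑ z ∈ S, p z) / Real.log 2 := by
        rw [Finset.sum_add_distrib, ← Finset.sum_mul, ← Finset.sum_div, Finset.sum_sub_distrib,
          ← Finset.sum_div]
    _ ≤ _ := by gcongr

/-- If the conditional spectrum is `ε`-close to `c` off a set of mass less than `m`, then its
expectation is close to `c`. -/
lemma abs_expectation_sub_le {α β : Type*} [Fintype α] [Fintype β] {p : α × β → ℝ} {r : β → ℝ}
    (hp : ∀ z, 0 ≤ p z) (hr : ∀ u, ∑ y, p (y, u) = r u) (h1 : ∑ z, p z = 1)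
    {m ε c : ℝ} (hm0 : 0 < m) (hm1 : m < 1 / 2) (hε : 0 < ε) (hc : 0 < c)
    (h : ∑ z with |-Real.logb 2 (p z / r z.2) - c| > ε, p z < m) :
    |∑ z, p z * -Real.logb 2 (p z / r z.2) - c| ≤
      ε + m * Real.logb 2 ((Fintype.card α : ℝ) / m ^ 2) := by
  have hl : 1 / 2 < Real.log 2 := by linarith [Real.log_two_gt_d9]
  have hK : (1 : ℝ) ≤ Fintype.card α := by
    rw [Nat.one_le_cast, Nat.one_le_iff_ne_zero]
    intro h0
    have := Fintype.card_eq_zero_iff.mp h0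
    simp at h1
  set K : ℝ := (Fintype.card α : ℝ)
  have hK0 : 0 < K := by linarith
  set g : α × β → ℝ := fun z => -Real.logb 2 (p z / r z.2)
  set B : Finset (α × β) := {z | |g z - c| > ε}
  set b := ∑ z ∈ B, p z with hb
  have hb0 : 0 ≤ b := Finset.sum_nonneg fun z _ => hp z
  have hT : ∑ z ∈ Bᶜ, p z = 1 - b := by
    rw [← h1, ← Finset.sum_add_sum_compl B p, hb]; ring
  have hsplit : ∑ z, p z * g z = ∑ z ∈ B, p z * g z + ∑ z ∈ Bᶜ, p z * g z :=
    (Finset.sum_add_sum_compl B _).symm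
  have hmem : ∀ z ∈ Bᶜ, |g z - c| ≤ ε := fun z hz => by simpa [B] using hz
  have hTlow : (1 - b) * (c - ε) ≤ ∑ z ∈ Bᶜ, p z * g z := by
    rw [← hT, Finset.sum_mul]
    exact Finset.sum_le_sum fun z hz => mul_le_mul_of_nonneg_left
      (by linarith [(abs_le.mp (hmem z hz)).1]) (hp z)
  have hTup : ∑ z ∈ Bᶜ, p z * g z ≤ (1 - b) * (c + ε) := by
    rw [← hT, Finset.sum_mul]
    exact Finset.sum_le_sum fun z hz => mul_le_mul_of_nonneg_left
      (by linarith [(abs_le.mp (hmem z hz)).2]) (hp z)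
  have hg0 : ∀ z, 0 ≤ g z := fun z => by
    have hpr : p z ≤ r z.2 := by
      rw [← hr]
      exact Finset.single_le_sum (f := fun y => p (y, z.2)) (fun y _ => hp _) (Finset.mem_univ z.1)
    have hr0 : 0 ≤ r z.2 := (hp z).trans hpr
    exact neg_nonneg.mpr <| div_nonpos_of_nonpos_of_nonneg
      (Real.log_nonpos (div_nonneg (hp z) hr0) (div_le_one_of_le₀ hpr hr0)) (by linarith)
  have hB0 : 0 ≤ ∑ z ∈ B, p z * g z := Finset.sum_nonneg fun z _ => mul_nonneg (hp z) (hg0 z)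
  have hBup := sum_mul_neg_logb_le hp hr h1 B (show 0 < K / m by positivity)
  have hTlog := sum_mul_neg_logb_le hp hr h1 Bᶜ (show 0 < 2 * K by positivity)
  change ∑ z ∈ B, p z * g z ≤ b * _ + (K / (K / m) - b) / _ at hBup
  change ∑ z ∈ Bᶜ, p z * g z ≤ _ * _ + (K / (2 * K) - _) / _ at hTlog
  rw [hT] at hTlog
  have e1 : K / (K / m) = m := by field_simp
  have e2 : K / (2 * K) = 1 / 2 := by field_simp
  rw [e1, Real.logb_div hK0.ne' hm0.ne'] at hBup
  rw [e2, Real.logb_mul two_ne_zero hK0.ne', Real.logb_self_eq_one one_lt_two] at hTlog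
  rw [Real.logb_div hK0.ne' (by positivity), Real.logb_pow, hsplit]
  have hLK : 0 ≤ Real.logb 2 K := Real.logb_nonneg one_lt_two hK
  have hLm : Real.logb 2 m ≤ -1 := by
    rw [Real.logb_le_iff_le_rpow one_lt_two hm0, Real.rpow_neg_one]; linarith
  set k := Real.logb 2 K
  set l := Real.logb 2 m
  have f1 : (m - b) / Real.log 2 ≤ (m - b) * 2 := by
    rw [div_le_iff₀ (by linarith)]; nlinarith
  have f2 : (1 / 2 - (1 - b)) / Real.log 2 ≤ 0 :=
    div_nonpos_of_nonpos_of_nonneg (by linarith) (by linarith)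
  have f3 : c - ε ≤ 1 + k := le_of_mul_le_mul_left (a := 1 - b) (by linarith) (by linarith)
  have f4 : b * (c - ε) ≤ m * (k - 2 * l) :=
    calc b * (c - ε) ≤ b * (1 + k) := by gcongr
      _ ≤ m * (1 + k) := by gcongr
      _ ≤ m * (k - 2 * l) := by gcongr; linarith
  have f5 : b * (k - l) + (m - b) * 2 ≤ m * (k - 2 * l) := by nlinarith
  push_cast
  rw [abs_le]
  constructor
  · linarith
  · have : 0 ≤ b * (c + ε) := by positivity
    linarith

/-- Corollary to Lemma `daco entropy`. -/
theorem stability_entropy_spectrum_bound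
    {Ω 𝒴 𝒰 : Type} [Fintype 𝒴] [Fintype 𝒰]
    (μ : PMF Ω) (Y : Ω → 𝒴) (U : Ω → 𝒰)
    (m ε c : ℝ) (hm0 : 0 < m) (hm1 : m < 1 / 2) (hε : 0 < ε) (hc : 0 < c)
    (h : pr μ {ω | |hcs μ Y U (Y ω) (U ω) - c| > ε} < m) :
    pr μ {ω | |hcs μ Y U (Y ω) (U ω) - Hc μ Y U| >
      2 * ε + m * Real.logb 2 ((Fintype.card 𝒴 : ℝ) / m ^ 2)} < m := by
  set f : Ω → 𝒴 × 𝒰 := fun ω => (Y ω, U ω)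
  set p : 𝒴 × 𝒰 → ℝ := fun z => (μ.map f z).toReal
  set r : 𝒰 → ℝ := fun u => pr μ {ω | U ω = u}
  have hp : ∀ z, 0 ≤ p z := fun _ => ENNReal.toReal_nonneg
  have h1 : ∑ z, p z = 1 := sum_toReal_eq_one _
  have hr : ∀ u, ∑ y, p (y, u) = r u := fun u => by
    rw [show r u = _ from pr_setOf_eq_sum μ f fun z => z.2 = u, Finset.sum_filter,
      Fintype.sum_prod_type]
    simp [p]
  have hj : ∀ z : 𝒴 × 𝒰, pr μ ({ω | Y ω = z.1} ∩ {ω | U ω = z.2}) = p z := fun z => by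
    have hz : {ω | Y ω = z.1} ∩ {ω | U ω = z.2} = {ω | f ω = z} := by
      ext ω; simp [f, Prod.ext_iff]
    rw [hz, pr_setOf_eq_sum μ f fun z' => z' = z]
    rw [Finset.sum_filter]
    refine (Finset.sum_eq_single z (fun z' _ hne => if_neg hne) ?_).trans (if_pos rfl)
    exact fun hz => absurd (Finset.mem_univ z) hz
  have hg : ∀ z : 𝒴 × 𝒰, hcs μ Y U z.1 z.2 = -Real.logb 2 (p z / r z.2) := fun z => by
    rw [hcs, cpr, hj]
  have hH : Hc μ Y U = ∑ z, p z * -Real.logb 2 (p z / r z.2) := by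
    simp only [mul_neg, Finset.sum_neg_distrib, Fintype.sum_prod_type, Hc, cpr]
    congr 1
    refine Finset.sum_congr rfl fun y _ => Finset.sum_congr rfl fun u _ => ?_
    rw [hj (y, u)]
  rw [pr_setOf_eq_sum μ f fun z => |hcs μ Y U z.1 z.2 - c| > ε] at h
  have h' : ∑ z with |-Real.logb 2 (p z / r z.2) - c| > ε, p z < m := by
    simpa only [hg] using h
  have hE := abs_expectation_sub_le hp hr h1 hm0 hm1 hε hc h'
  rw [← hH] at hE
  rw [pr_setOf_eq_sum μ f fun z => |hcs μ Y U z.1 z.2 - Hc μ Y U| > _]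
  refine (Finset.sum_le_sum_of_subset_of_nonneg ?_ fun z _ _ => hp z).trans_lt h
  refine Finset.monotone_filter_right _ fun z _ hz => ?_
  have htri := abs_sub_le (hcs μ Y U z.1 z.2) c (Hc μ Y U)
  rw [abs_sub_comm c] at htri
  linarith

end Paper
end
end
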